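/- arXiv:1110.3653 — 2 statements merged into one kernel-verified Lean document; each statement's English description precedes it below -/
import Mathlib

section
/- Let G be an abelian group, let B ⊆ G be a submonoid, let A ⊆ B be a submonoid, and let R be a commutative integral domain. For each coset g of G(A) in G(B), let M_g denote the R-submodule of R[B] spanned by {t^b : b ∈ B, b ∈ g}. Then for all cosets g₁, g₂ ∈ G(B)/G(A) one has M_{g₁} · M_{g₂} ⊆ M_{g₁+g₂}; together with the direct-sum decomposition R[B] = ⊕_g M_g, the family (M_g) makes R[B] a G(B)/G(A)-graded R-algebra. -/
noncomputable section

/-- The subgroup of the ambient abelian group generated by a submonoid. -/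
abbrev grpOf {G : Type*} [AddCommGroup G] (A : AddSubmonoid G) : AddSubgroup G :=
  AddSubgroup.closure (A : Set G)

/-- The coset of `G(A)` in `G(B)` determined by an element `b ∈ B`. -/
def cosetOf {G : Type*} [AddCommGroup G] (A B : AddSubmonoid G) (b : B) :
    grpOf B ⧸ (grpOf A).addSubgroupOf (grpOf B) :=
  QuotientAddGroup.mk ⟨(b : G), AddSubgroup.subset_closure b.2⟩

/-- The `R`-submodule of `R[B]` spanned by the basis elements `t^b` with `b ∈ B` lying in the
coset `g` of `G(A)` inside `G(B)`. -/
def Mg {G : Type*} [AddCommGroup G] (R : Type*) [CommRing R] (A B : AddSubmonoid G)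
    (g : grpOf B ⧸ (grpOf A).addSubgroupOf (grpOf B)) :
    Submodule R (AddMonoidAlgebra R B) :=
  Submodule.span R {x | ∃ b : B, cosetOf A B b = g ∧ x = AddMonoidAlgebra.single b 1}

/-- The map sending `b ∈ B` to its coset of `G(A)` in `G(B)`, as an additive homomorphism. -/
def cosetHom {G : Type*} [AddCommGroup G] (A B : AddSubmonoid G) :
    B →+ grpOf B ⧸ (grpOf A).addSubgroupOf (grpOf B) where
  toFun := cosetOf A B
  map_zero' := rfl
  map_add' _ _ := rfl

theorem Mg_eq_gradeBy {G : Type*} [AddCommGroup G] (R : Type*) [CommRing R]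
    (A B : AddSubmonoid G) :
    Mg R A B = AddMonoidAlgebra.gradeBy R (cosetHom A B) := by
  funext g
  apply le_antisymm
  · refine Submodule.span_le.2 ?_
    rintro _ ⟨b, rfl, rfl⟩
    exact AddMonoidAlgebra.single_mem_gradeBy (cosetHom A B) b 1
  · intro x hx
    rw [← AddMonoidAlgebra.sum_coeff_single x]
    refine Submodule.sum_mem _ fun b hb => ?_
    have h : AddMonoidAlgebra.single b (x.coeff b) =
        x.coeff b • (AddMonoidAlgebra.single b 1 : AddMonoidAlgebra R B) := by
      simp
    rw [h]
    exact Submodule.smul_mem _ _ (Submodule.subset_span ⟨b, hx b hb, rfl⟩)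

/-- For all cosets `g₁, g₂ ∈ G(B)/G(A)` one has
`M_{g₁} · M_{g₂} ⊆ M_{g₁+g₂}`, and together with the direct-sum decomposition
`R[B] = ⊕_g M_g` the family `(M_g)` makes `R[B]` a `G(B)/G(A)`-graded `R`-algebra. -/
theorem semigroup_algebra_graded
    {G : Type*} [AddCommGroup G] (R : Type*) [CommRing R] [IsDomain R]
    (A B : AddSubmonoid G) (hAB : A ≤ B)
    [DecidableEq (grpOf B ⧸ (grpOf A).addSubgroupOf (grpOf B))] :
    (∀ g₁ g₂ : grpOf B ⧸ (grpOf A).addSubgroupOf (grpOf B),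
        Mg R A B g₁ * Mg R A B g₂ ≤ Mg R A B (g₁ + g₂)) ∧
    DirectSum.IsInternal (fun g : grpOf B ⧸ (grpOf A).addSubgroupOf (grpOf B) =>
      Mg R A B g) ∧
    Nonempty (GradedAlgebra (fun g : grpOf B ⧸ (grpOf A).addSubgroupOf (grpOf B) =>
      Mg R A B g)) := by
  rw [Mg_eq_gradeBy]
  refine ⟨fun g₁ g₂ => Submodule.mul_le.2 fun x hx y hy => ?_,
    AddMonoidAlgebra.gradeBy.isInternal (cosetHom A B),
    ⟨AddMonoidAlgebra.gradeBy.gradedAlgebra (cosetHom A B)⟩⟩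
  exact (AddMonoidAlgebra.gradeBy.gradedMonoid (R := R) (cosetHom A B)).mul_mem hx hy
end
end

section
/- Let A ⊆ B ⊆ ℕ^m be positive affine semigroups and let K be a field. Then the monoid algebra K[B] is a finitely generated module over the monoid algebra K[A] (via the algebra map induced by the inclusion A ⊆ B) if and only if C(A) = C(B). -/
open Pointwise

noncomputable section

/-- Coordinatewise cast `ℕ^m → ℚ^m`. -/
def natCastQ {m : ℕ} (x : Fin m → ℕ) : Fin m → ℚ := fun i => (x i : ℚ)

/-- Coordinatewise cast `ℕ^m → ℤ^m`. -/
def natCastZ {m : ℕ} (x : Fin m → ℕ) : Fin m → ℤ := fun i => (x i : ℤ)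

/-- Coordinatewise cast `ℤ^m → ℚ^m`. -/
def intCastQ {m : ℕ} (x : Fin m → ℤ) : Fin m → ℚ := fun i => (x i : ℚ)

/-- The rational convex cone spanned by a subset of `ℕ^m` inside `ℚ^m`. -/
def ratCone {m : ℕ} (X : Set (Fin m → ℕ)) : Set (Fin m → ℚ) :=
  {y | ∃ (k : ℕ) (q : Fin k → ℚ) (x : Fin k → (Fin m → ℕ)),
    (∀ i, 0 ≤ q i) ∧ (∀ i, x i ∈ X) ∧ y = ∑ i, q i • natCastQ (x i)}

/-- `B_A = {x ∈ B : x ∉ B + (A ∖ {0})}`. -/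
def BA {m : ℕ} (A B : AddSubmonoid (Fin m → ℕ)) : Set (Fin m → ℕ) :=
  {x | x ∈ B ∧ x ∉ (B : Set (Fin m → ℕ)) + ((A : Set (Fin m → ℕ)) \ {0})}

/-- The subgroup of `ℤ^m` generated by a subset of `ℕ^m`. -/
def grpZ {m : ℕ} (X : Set (Fin m → ℕ)) : AddSubgroup (Fin m → ℤ) :=
  AddSubgroup.closure (natCastZ '' X)

namespace AddMonoidAlgebra

variable {R M N : Type*} [CommRing R] [AddCommMonoid M] [AddCommMonoid N] {f : M →+ N}

theorem exists_nsmul_mem_mrange_of_isIntegralElem [Nontrivial R] [IsCancelAdd N] {b : N}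
    (h : (mapDomainRingHom R f).IsIntegralElem (single b 1)) :
    ∃ n : ℕ, 0 < n ∧ n • b ∈ AddMonoidHom.mrange f := by
  classical
  obtain ⟨p, hp, hpb⟩ := h
  by_contra! hb
  have hcoeff : ∀ i ∈ Finset.range p.natDegree,
      (mapDomainRingHom R f (p.coeff i) * single (i • b) (1 : R)).coeff (p.natDegree • b) = 0 := by
    intro i hi
    rw [Finset.mem_range] at hi
    by_contra hne
    obtain ⟨c, hc, hcb⟩ := Finset.mem_image.1
      (support_coeff_mul_single_subset _ _ _ (Finsupp.mem_support_iff.2 hne))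
    obtain ⟨a, -, rfl⟩ := Finset.mem_image.1 (Finsupp.mapDomain_support hc)
    refine hb (p.natDegree - i) (by omega) ⟨a, add_right_cancel (b := i • b) ?_⟩
    rw [← add_nsmul, Nat.sub_add_cancel hi.le]
    exact hcb
  have key := congrArg (fun x ↦ x.coeff (p.natDegree • b)) hpb
  simp only [Polynomial.eval₂_eq_sum_range, single_pow, one_pow, Finset.sum_range_succ,
    hp.coeff_natDegree, map_one, one_mul, coeff_add, coeff_sum, Finsupp.add_apply,
    Finsupp.finsetSum_apply, Finset.sum_eq_zero hcoeff, coeff_single, Finsupp.single_eq_same,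
    zero_add, coeff_zero, Finsupp.zero_apply] at key
  exact one_ne_zero key

theorem isIntegral_mapDomainRingHom_of_exists_nsmul_mem_mrange
    (h : ∀ b : N, ∃ n : ℕ, 0 < n ∧ n • b ∈ AddMonoidHom.mrange f) :
    (mapDomainRingHom R f).IsIntegral := by
  intro x
  induction x using induction_linear with
  | zero => exact RingHom.isIntegralElem_zero _
  | add x y hx hy => exact hx.add _ hy
  | single b r =>
    obtain ⟨n, hn, a, ha⟩ := h b
    have hpow : mapDomainRingHom R f (single a (r ^ n)) = single b r ^ n := by
      rw [single_pow, ← ha]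
      exact mapDomain_single ..
    refine ⟨Polynomial.X ^ n - Polynomial.C (single a (r ^ n)),
      Polynomial.monic_X_pow_sub_C _ hn.ne', ?_⟩
    rw [Polynomial.eval₂_sub, Polynomial.eval₂_X_pow, Polynomial.eval₂_C, hpow, sub_self]

theorem finite_mapDomainRingHom_iff [Nontrivial R] [IsCancelAdd N] [AddMonoid.FG N] :
    (mapDomainRingHom R f).Finite ↔
      ∀ b : N, ∃ n : ℕ, 0 < n ∧ n • b ∈ AddMonoidHom.mrange f := by
  refine ⟨fun h b ↦ exists_nsmul_mem_mrange_of_isIntegralElem (h.to_isIntegral _),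
    fun h ↦ (isIntegral_mapDomainRingHom_of_exists_nsmul_mem_mrange h).to_finite ?_⟩
  refine RingHom.FiniteType.of_comp_finiteType (f := algebraMap R R[M]) ?_
  rw [mapDomainRingHom_comp_algebraMap, RingHom.finiteType_algebraMap]
  infer_instance

end AddMonoidAlgebra

theorem natCastQ_nsmul {m : ℕ} (n : ℕ) (x : Fin m → ℕ) :
    natCastQ (n • x) = (n : ℚ) • natCastQ x := by
  ext j
  simp [natCastQ]

theorem natCastQ_sum {m : ℕ} {ι : Type*} (s : Finset ι) (x : ι → Fin m → ℕ) :
    natCastQ (∑ i ∈ s, x i) = ∑ i ∈ s, natCastQ (x i) := by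
  ext j
  simp [natCastQ]

theorem natCastQ_injective {m : ℕ} : Function.Injective (natCastQ (m := m)) :=
  fun _ _ h ↦ funext fun j ↦ Nat.cast_injective (congrFun h j)

theorem ratCone_mono {m : ℕ} {X Y : Set (Fin m → ℕ)} (h : X ⊆ Y) : ratCone X ⊆ ratCone Y := by
  rintro _ ⟨k, q, x, hq, hx, rfl⟩
  exact ⟨k, q, x, hq, fun i ↦ h (hx i), rfl⟩

theorem natCastQ_mem_ratCone {m : ℕ} {X : Set (Fin m → ℕ)} {x : Fin m → ℕ} (hx : x ∈ X) :
    natCastQ x ∈ ratCone X :=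
  ⟨1, fun _ ↦ 1, fun _ ↦ x, by simp, by simpa using hx, by simp⟩

theorem exists_pos_forall_mul_eq_natCast {ι : Type*} [Fintype ι] {q : ι → ℚ} (hq : ∀ i, 0 ≤ q i) :
    ∃ n : ℕ, 0 < n ∧ ∃ c : ι → ℕ, ∀ i, (n : ℚ) * q i = c i := by
  have hden : ∀ i, ∃ c : ℕ, ((∏ j, (q j).den : ℕ) : ℚ) * q i = c := by
    intro i
    obtain ⟨d, hd⟩ := Finset.dvd_prod_of_mem (fun j ↦ (q j).den) (Finset.mem_univ i)
    refine ⟨d * (q i).num.toNat, ?_⟩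
    have hnum : (((q i).num.toNat : ℕ) : ℚ) = (q i).num := by
      exact_mod_cast Int.toNat_of_nonneg (Rat.num_nonneg.2 (hq i))
    rw [hd, Nat.cast_mul, Nat.cast_mul, hnum, ← Rat.mul_den_eq_num]
    ring
  choose c hc using hden
  exact ⟨_, Finset.prod_pos fun j _ ↦ (q j).den_pos, c, hc⟩

theorem exists_nsmul_mem_of_natCastQ_mem_ratCone {m : ℕ} {A : AddSubmonoid (Fin m → ℕ)}
    {b : Fin m → ℕ} (hb : natCastQ b ∈ ratCone (A : Set (Fin m → ℕ))) :
    ∃ n : ℕ, 0 < n ∧ n • b ∈ A := by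
  obtain ⟨k, q, x, hq, hx, hbx⟩ := hb
  obtain ⟨n, hn, c, hc⟩ := exists_pos_forall_mul_eq_natCast hq
  refine ⟨n, hn, ?_⟩
  have hsum : n • b = ∑ i, c i • x i := natCastQ_injective <| by
    simp only [natCastQ_nsmul, natCastQ_sum, hbx, Finset.smul_sum, smul_smul, hc]
  rw [hsum]
  exact sum_mem fun i _ ↦ nsmul_mem (hx i) _

theorem ratCone_eq_iff_exists_nsmul_mem {m : ℕ} {A B : AddSubmonoid (Fin m → ℕ)} (hAB : A ≤ B) :
    ratCone (A : Set (Fin m → ℕ)) = ratCone (B : Set (Fin m → ℕ)) ↔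
      ∀ b ∈ B, ∃ n : ℕ, 0 < n ∧ n • b ∈ A := by
  refine ⟨fun h b hb ↦ exists_nsmul_mem_of_natCastQ_mem_ratCone
    (h ▸ natCastQ_mem_ratCone (SetLike.mem_coe.2 hb)), fun h ↦ (ratCone_mono hAB).antisymm ?_⟩
  rintro _ ⟨k, q, x, hq, hx, rfl⟩
  choose n hn hnA using fun i ↦ h (x i) (hx i)
  refine ⟨k, fun i ↦ q i / n i, fun i ↦ n i • x i, fun i ↦ div_nonneg (hq i) (Nat.cast_nonneg _),
    hnA, Finset.sum_congr rfl fun i _ ↦ ?_⟩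
  have hni : (n i : ℚ) ≠ 0 := Nat.cast_ne_zero.2 (hn i).ne'
  rw [natCastQ_nsmul, smul_smul, div_mul_cancel₀ _ hni]

/-- `K[B]` is a finitely generated `K[A]`-module (via the map induced by the
inclusion `A ⊆ B`) if and only if `C(A) = C(B)`. -/
theorem finite_module_iff_cone_eq {m : ℕ} (K : Type*) [Field K]
    (A B : AddSubmonoid (Fin m → ℕ)) (hAB : A ≤ B) (hA : A.FG) (hB : B.FG) :
    (AddMonoidAlgebra.mapDomainRingHom K (AddSubmonoid.inclusion hAB)).Finite ↔
      ratCone (A : Set (Fin m → ℕ)) = ratCone (B : Set (Fin m → ℕ)) := by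
  have : AddMonoid.FG B := (AddMonoid.fg_iff_addSubmonoid_fg B).2 hB
  rw [AddMonoidAlgebra.finite_mapDomainRingHom_iff, ratCone_eq_iff_exists_nsmul_mem hAB,
    Subtype.forall]
  refine forall₂_congr fun b hb ↦ exists_congr fun n ↦ and_congr_right fun _ ↦ ?_
  constructor
  · rintro ⟨a, ha⟩
    have hab : (a : Fin m → ℕ) = n • b := congrArg Subtype.val ha
    exact hab ▸ a.2
  · exact fun h ↦ ⟨⟨n • b, h⟩, rfl⟩
end
end
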